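/- arXiv:2001.03568 — 3 statements merged into one kernel-verified Lean document; each statement's English description precedes it below -/
import Mathlib

section
/- Let G be a group and let H, S, T be subgroups of G such that for every g ∈ G the set (g H g⁻¹) ∩ {s·t : s ∈ S, t ∈ T} equals {1}. Let a, b ∈ G be such that the double cosets H a S and H b T have nonempty intersection. Then for every g ∈ G with H g S = H a S, there exists g' ∈ G such that H g' T = H b T and the left cosets g S and g' T have nonempty intersection; moreover the left coset g' T is unique with these two properties. -/
/-- If `x ∈ H y K` then the double cosets `H x K` and `H y K` coincide. -/
theorem doubleCoset_setOf_eq {G : Type*} [Group G] {H K : Subgroup G} {x y h k : G}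
    (hh : h ∈ H) (hk : k ∈ K) (hx : x = h * y * k) :
    {z : G | ∃ h ∈ H, ∃ k ∈ K, z = h * x * k} = {z : G | ∃ h ∈ H, ∃ k ∈ K, z = h * y * k} := by
  ext z
  constructor
  · rintro ⟨u, hu, v, hv, rfl⟩
    exact ⟨u * h, H.mul_mem hu hh, k * v, K.mul_mem hk hv, by rw [hx]; group⟩
  · rintro ⟨u, hu, v, hv, rfl⟩
    exact ⟨u * h⁻¹, H.mul_mem hu (H.inv_mem hh), k⁻¹ * v, K.mul_mem (K.inv_mem hk) hv,
      by rw [hx]; group⟩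

/-- If the double cosets `H x K` and `H y K` coincide then `x ∈ H y K`. -/
theorem exists_eq_mul_mul_of_setOf_eq {G : Type*} [Group G] {H K : Subgroup G} {x y : G}
    (hxy : {z : G | ∃ h ∈ H, ∃ k ∈ K, z = h * x * k} =
      {z : G | ∃ h ∈ H, ∃ k ∈ K, z = h * y * k}) :
    ∃ h ∈ H, ∃ k ∈ K, x = h * y * k := by
  have hx : x ∈ {z : G | ∃ h ∈ H, ∃ k ∈ K, z = h * x * k} :=
    ⟨1, H.one_mem, 1, K.one_mem, by simp⟩
  rwa [hxy] at hx

/-- If `x ∈ y K` then the left cosets `x K` and `y K` coincide. -/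
theorem leftCoset_setOf_eq {G : Type*} [Group G] {K : Subgroup G} {x y k : G}
    (hk : k ∈ K) (hx : x = y * k) :
    {z : G | ∃ k ∈ K, z = x * k} = {z : G | ∃ k ∈ K, z = y * k} := by
  ext z
  constructor
  · rintro ⟨v, hv, rfl⟩
    exact ⟨k * v, K.mul_mem hk hv, by rw [hx]; group⟩
  · rintro ⟨v, hv, rfl⟩
    exact ⟨k⁻¹ * v, K.mul_mem (K.inv_mem hk) hv, by rw [hx]; group⟩

/-- Lifting lemma for double cosets under the non-local subgroup condition:
if (gHg⁻¹) ∩ S·T = {1} for all g, and the double cosets HaS and HbT intersect,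
then for every g with HgS = HaS there is a (unique as a left coset) g'T with
Hg'T = HbT and gS ∩ g'T ≠ ∅. -/
theorem stmt_3 {G : Type*} [Group G] (H S T : Subgroup G)
    (hnl : ∀ g : G,
      {x : G | ∃ h ∈ H, x = g * h * g⁻¹} ∩
        {x : G | ∃ s ∈ S, ∃ t ∈ T, x = s * t} = {1})
    (a b : G)
    (hab : ({x : G | ∃ h ∈ H, ∃ s ∈ S, x = h * a * s} ∩
            {x : G | ∃ h ∈ H, ∃ t ∈ T, x = h * b * t}).Nonempty)
    (g : G)
    (hg : {x : G | ∃ h ∈ H, ∃ s ∈ S, x = h * g * s} =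
          {x : G | ∃ h ∈ H, ∃ s ∈ S, x = h * a * s}) :
    ∃ g' : G,
      ({x : G | ∃ h ∈ H, ∃ t ∈ T, x = h * g' * t} =
         {x : G | ∃ h ∈ H, ∃ t ∈ T, x = h * b * t} ∧
       ({x : G | ∃ s ∈ S, x = g * s} ∩ {x : G | ∃ t ∈ T, x = g' * t}).Nonempty) ∧
      ∀ g'' : G,
        ({x : G | ∃ h ∈ H, ∃ t ∈ T, x = h * g'' * t} =
           {x : G | ∃ h ∈ H, ∃ t ∈ T, x = h * b * t} ∧
         ({x : G | ∃ s ∈ S, x = g * s} ∩ {x : G | ∃ t ∈ T, x = g'' * t}).Nonempty) →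
        {x : G | ∃ t ∈ T, x = g'' * t} = {x : G | ∃ t ∈ T, x = g' * t} := by
  obtain ⟨_, ⟨h₁, hh₁, s₁, hs₁, rfl⟩, h₂, hh₂, t₂, ht₂, hab⟩ := hab
  obtain ⟨h, hh, s, hs, rfl⟩ := exists_eq_mul_mul_of_setOf_eq hg
  have hq : h * a * s * (s⁻¹ * s₁) = h * h₁⁻¹ * h₂ * b * t₂ := by
    calc h * a * s * (s⁻¹ * s₁) = h * h₁⁻¹ * (h₁ * a * s₁) := by group
      _ = h * h₁⁻¹ * h₂ * b * t₂ := by rw [hab]; group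
  have hr : s⁻¹ * s₁ ∈ S := S.mul_mem (S.inv_mem hs) hs₁
  have hcoset := doubleCoset_setOf_eq
    (H.mul_mem (H.mul_mem hh (H.inv_mem hh₁)) hh₂) ht₂ hq
  generalize h * a * s = g at *
  generalize s⁻¹ * s₁ = r at *
  refine ⟨g * r, ⟨hcoset, g * r, ⟨r, hr, rfl⟩, 1, T.one_mem, by simp⟩, ?_⟩
  rintro x ⟨hx, _, ⟨u, hu, rfl⟩, v, hv, huv⟩
  obtain ⟨k, hk, t, ht, rfl⟩ := exists_eq_mul_mul_of_setOf_eq (hx.trans hcoset.symm)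
  have hmem : (g * r)⁻¹ * k * (g * r) ∈ ({1} : Set G) := by
    rw [← hnl (g * r)⁻¹]
    refine ⟨⟨k, hk, by simp⟩, r⁻¹ * u, S.mul_mem (S.inv_mem hr) hu, (t * v)⁻¹,
      T.inv_mem (T.mul_mem ht hv), ?_⟩
    calc (g * r)⁻¹ * k * (g * r)
        = (g * r)⁻¹ * (k * (g * r) * t * v) * (t * v)⁻¹ := by group
      _ = r⁻¹ * u * (t * v)⁻¹ := by rw [← huv]; group
  refine leftCoset_setOf_eq ht ?_
  calc k * (g * r) * t = g * r * ((g * r)⁻¹ * k * (g * r)) * t := by group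
    _ = g * r * t := by rw [Set.mem_singleton_iff.mp hmem, mul_one]
end

section
/- Let S be a positive integer divisible by 14400, and let C_4 → C_3 → C_2 → C_1 → C_0 be a chain complex over 𝔽₂ (linear maps ∂_i : C_i → C_{i−1} with ∂_i ∘ ∂_{i+1} = 0) whose chain spaces have dimensions dim C_0 = dim C_4 = S/14400, dim C_1 = dim C_3 = S/240, and dim C_2 = S/100, and whose homology groups satisfy dim H_0 = dim H_4 = 1. Then dim H_2 ≥ (13/72)·dim C_2 − 2, i.e., 72·dim H_2 ≥ 13·dim C_2 − 144. -/
open Module in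
/-- The dimension of `q ⧸ p`, for submodules `p ≤ q` of a finite-dimensional space. -/
theorem finrank_quotient_comap_subtype_add {K V : Type*} [DivisionRing K] [AddCommGroup V]
    [Module K V] [FiniteDimensional K V] {p q : Submodule K V} (h : p ≤ q) :
    finrank K (q ⧸ Submodule.comap q.subtype p) + finrank K p = finrank K q := by
  rw [← (Submodule.comapSubtypeEquivOfLe h).finrank_eq]
  exact Submodule.finrank_quotient_add_finrank _

open Module LinearMap in
/-- The dimension of the homology of `U → V → W` at `V`. -/
theorem finrank_homology_add {K U V W : Type*} [DivisionRing K]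
    [AddCommGroup U] [Module K U] [AddCommGroup V] [Module K V] [FiniteDimensional K V]
    [AddCommGroup W] [Module K W] (f : U →ₗ[K] V) (g : V →ₗ[K] W) (h : g.comp f = 0) :
    finrank K (ker g ⧸ Submodule.comap (ker g).subtype (range f)) + finrank K (range f) +
      finrank K (range g) = finrank K V := by
  rw [finrank_quotient_comap_subtype_add (range_le_ker_iff.2 h), add_comm,
    finrank_range_add_finrank_ker]

open Module LinearMap in
theorem finrank_range_add_finrank_range_le {K U V W : Type*} [DivisionRing K]
    [AddCommGroup U] [Module K U] [AddCommGroup V] [Module K V] [FiniteDimensional K V]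
    [AddCommGroup W] [Module K W] (f : U →ₗ[K] V) (g : V →ₗ[K] W) (h : g.comp f = 0) :
    finrank K (range f) + finrank K (range g) ≤ finrank K V := by
  have := finrank_homology_add f g h
  omega


/-- For the chain complex of a {5,3,3,5} tessellation with S fundamental simplices
(dim C_0 = dim C_4 = S/14400, dim C_1 = dim C_3 = S/240, dim C_2 = S/100,
dim H_0 = dim H_4 = 1), the number of logical qubits k = dim H_2 satisfies
k ≥ (13/72)·n − 2 where n = dim C_2. -/
theorem stmt_11 (S : ℕ) (hSpos : 0 < S) (hdvd : 14400 ∣ S)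
    (C : ℕ → Type*) [∀ i, AddCommGroup (C i)]
    [∀ i, Module (ZMod 2) (C i)] [∀ i, FiniteDimensional (ZMod 2) (C i)]
    (d : ∀ i : ℕ, C i →ₗ[ZMod 2] C (i - 1))
    (h0 : d 0 = 0) (h5 : d 5 = 0)
    (hcomp : ∀ i, 1 ≤ i → i ≤ 3 → (d i).comp (d (i + 1)) = 0)
    (hC0 : Module.finrank (ZMod 2) (C 0) = S / 14400)
    (hC4 : Module.finrank (ZMod 2) (C 4) = S / 14400)
    (hC1 : Module.finrank (ZMod 2) (C 1) = S / 240)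
    (hC3 : Module.finrank (ZMod 2) (C 3) = S / 240)
    (hC2 : Module.finrank (ZMod 2) (C 2) = S / 100)
    (hH0 : Module.finrank (ZMod 2)
        (LinearMap.ker (d 0) ⧸
          Submodule.comap (LinearMap.ker (d 0)).subtype (LinearMap.range (d 1))) = 1)
    (hH4 : Module.finrank (ZMod 2)
        (LinearMap.ker (d 4) ⧸
          Submodule.comap (LinearMap.ker (d 4)).subtype (LinearMap.range (d 5))) = 1) :
    (72 : ℤ) * Module.finrank (ZMod 2)
        (LinearMap.ker (d 2) ⧸
          Submodule.comap (LinearMap.ker (d 2)).subtype (LinearMap.range (d 3))) ≥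
      13 * Module.finrank (ZMod 2) (C 2) - 144 := by
  have e0 := finrank_homology_add (V := C 0) (d 1) (d 0) (by rw [h0]; exact LinearMap.zero_comp _)
  have e4 := finrank_homology_add (V := C 4) (d 5) (d 4) (by rw [h5]; exact LinearMap.comp_zero _)
  have e2 := finrank_homology_add (V := C 2) (d 3) (d 2) (hcomp 2 (by simp) (by simp))
  have e1 := finrank_range_add_finrank_range_le (V := C 1) (d 2) (d 1) (hcomp 1 (by simp) (by simp))
  have e3 := finrank_range_add_finrank_range_le (V := C 3) (d 4) (d 3) (hcomp 3 (by simp) (by simp))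
  have r0 : Module.finrank (ZMod 2) (LinearMap.range (d 0)) = 0 := by
    rw [h0, LinearMap.range_zero, finrank_bot]
  have r5 : Module.finrank (ZMod 2) (LinearMap.range (d 5)) = 0 := by
    rw [h5, LinearMap.range_zero, finrank_bot]
  obtain ⟨m, rfl⟩ := hdvd
  simp only [Nat.reduceSub] at *
  omega
end

section
/- Let R = ℤ[X]/⟨X² − X − 1⟩ and let n ≥ 1. For every finite set F of n×n matrices with entries in R, none of which equals the identity matrix, there exists a maximal ideal I of R such that for every M ∈ F the matrix obtained by applying the quotient map R → R/I to each entry of M is not the identity matrix of M_n(R/I). -/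
open Polynomial

theorem Ideal.exists_isMaximal_notMem_of_ne_zero {R : Type*} [CommRing R] [IsReduced R]
    [IsJacobsonRing R] {d : R} (hd : d ≠ 0) : ∃ I : Ideal R, I.IsMaximal ∧ d ∉ I := by
  have h : d ∉ (⊥ : Ideal R).jacobson := by
    rw [IsJacobsonRing.out inferInstance isRadical_bot]
    simpa using hd
  simp only [Ideal.jacobson, Ideal.mem_sInf, not_forall] at h
  obtain ⟨I, ⟨-, hI⟩, hdI⟩ := h
  exact ⟨I, hI, hdI⟩

theorem Matrix.exists_isMaximal_forall_map_mk_ne_one {R m : Type*} [CommRing R] [IsDomain R]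
    [IsJacobsonRing R] [DecidableEq m] (F : Finset (Matrix m m R)) (hF : ∀ M ∈ F, M ≠ 1) :
    ∃ I : Ideal R, I.IsMaximal ∧ ∀ M ∈ F, M.map (Ideal.Quotient.mk I) ≠ 1 := by
  have h : ∀ M : Matrix m m R, ∃ d : R, M ∈ F → d ≠ 0 ∧
      ∀ I : Ideal R, M.map (Ideal.Quotient.mk I) = 1 → d ∈ I := by
    intro M
    by_cases hM : M ∈ F
    · obtain ⟨i, j, hij⟩ : ∃ i j, M i j ≠ (1 : Matrix m m R) i j := by
        by_contra! h
        exact hF M hM (Matrix.ext h)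
      refine ⟨M i j - (1 : Matrix m m R) i j, fun _ => ⟨sub_ne_zero.2 hij, fun I hI => ?_⟩⟩
      rw [← Matrix.map_one (Ideal.Quotient.mk I) (map_zero _) (map_one _)] at hI
      exact Ideal.Quotient.eq.1 (congrFun (congrFun hI i) j)
    · exact ⟨0, fun h => absurd h hM⟩
  choose d hd using h
  obtain ⟨I, hI, hdI⟩ := Ideal.exists_isMaximal_notMem_of_ne_zero
    (Finset.prod_ne_zero_iff.2 fun M hM => (hd M hM).1)
  exact ⟨I, hI, fun M hM h => hdI (I.mem_of_dvd (Finset.dvd_prod_of_mem d hM) ((hd M hM).2 I h))⟩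

theorem Int.prime_X_sq_sub_X_sub_one : Prime (X ^ 2 - X - 1 : ℤ[X]) := by
  have hdeg : (X ^ 2 - X - 1 : ℤ[X]).natDegree = 2 := by compute_degree!
  have hmonic : (X ^ 2 - X - 1 : ℤ[X]).Monic := by monicity!
  refine ((hmonic.irreducible_iff_roots_eq_zero_of_degree_le_three hdeg.ge
    (hdeg.trans_le (by norm_num))).2 (Multiset.eq_zero_of_forall_notMem fun r hr => ?_)).prime
  have h : r ^ 2 - r - 1 = 0 := by simpa using (mem_roots'.1 hr).2
  have h_even : Even (r * (r - 1)) := Int.even_mul_pred_self r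
  rw [show r * (r - 1) = 1 by linarith] at h_even
  exact absurd h_even (by decide)

theorem Int.isJacobsonRing : IsJacobsonRing ℤ := by
  refine isJacobsonRing_iff_prime_eq.2 fun P hP => ?_
  rcases eq_or_ne P ⊥ with rfl | hP0
  · refine eq_bot_iff.2 fun x hx => ?_
    have h := Int.isUnit_iff.1 (Ideal.mem_jacobson_bot.1 hx x)
    rw [Ideal.mem_bot]
    rcases h with h | h <;> nlinarith
  · have := hP.isMaximal hP0
    exact Ideal.jacobson_eq_self_of_isMaximal

/-- For any finite set of non-identity n×n matrices over ℤ[φ] = ℤ[X]/⟨X²−X−1⟩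
there is a maximal ideal I such that no matrix of the set reduces to the
identity modulo I. -/
theorem stmt_12 (n : ℕ) (hn : 1 ≤ n)
    (F : Finset (Matrix (Fin n) (Fin n) (ℤ[X] ⧸ Ideal.span {(X ^ 2 - X - 1 : ℤ[X])})))
    (hF : ∀ M ∈ F, M ≠ 1) :
    ∃ I : Ideal (ℤ[X] ⧸ Ideal.span {(X ^ 2 - X - 1 : ℤ[X])}), I.IsMaximal ∧
      ∀ M ∈ F, M.map (Ideal.Quotient.mk I) ≠ 1 := by
  have : (Ideal.span {(X ^ 2 - X - 1 : ℤ[X])}).IsPrime :=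
    (Ideal.span_singleton_prime Int.prime_X_sq_sub_X_sub_one.ne_zero).2
      Int.prime_X_sq_sub_X_sub_one
  have := Int.isJacobsonRing
  exact Matrix.exists_isMaximal_forall_map_mk_ne_one F hF
end
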